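/- Let η₄ = (1/2)(e₀₀₀₀ + e₀₀₁₁ + e₁₁₀₀ − e₁₁₁₁) ∈ ℂ¹⁶ be the four-qubit cluster state. Then the partial trace of |η₄⟩⟨η₄| over the last qubit equals (1/2)·|Φ⁺⟩⟨Φ⁺| ⊗ |e₀⟩⟨e₀| + (1/2)·|Φ⁻⟩⟨Φ⁻| ⊗ |e₁⟩⟨e₁| as an 8×8 matrix, where Φ± = (1/√2)(e₀₀ ± e₁₁) ∈ ℂ⁴. In particular, this reduced three-qubit state is a convex combination of Kronecker products of a two-qubit density matrix (on the first two qubits) with a one-qubit density matrix (on the third qubit), i.e. it is biseparable across the cut separating the third qubit. -/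

import Mathlib

open Matrix ComplexOrder Kronecker

/-- A density matrix: positive semidefinite with unit trace. -/
def IsDensityMatrix {d : Type*} [Fintype d] [DecidableEq d]
    (ρ : Matrix d d ℂ) : Prop :=
  ρ.PosSemidef ∧ ρ.trace = 1

/-- Standard basis vector of `ℂ²`. -/
def qubit (i : Fin 2) : Fin 2 → ℂ := fun j => if j = i then 1 else 0

/-- Standard basis vector `e_{ab}` of `ℂ⁴ = ℂ²⊗ℂ²`. -/
def e2 (i j : Fin 2) : Fin 2 × Fin 2 → ℂ := fun q => if q = (i, j) then 1 else 0

/-- Standard basis vector `e_{abcd}` of `ℂ¹⁶` (last qubit split off). -/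
def e4 (i j k l : Fin 2) : ((Fin 2 × Fin 2) × Fin 2) × Fin 2 → ℂ :=
  fun q => if q = (((i, j), k), l) then 1 else 0

/-- Partial trace over the second factor. -/
noncomputable def ptrace {α β : Type*} [Fintype β]
    (ρ : Matrix (α × β) (α × β) ℂ) : Matrix α α ℂ :=
  Matrix.of fun s t => ∑ u, ρ (s, u) (t, u)

/-- The four-qubit cluster state `η₄ = (e₀₀₀₀ + e₀₀₁₁ + e₁₁₀₀ − e₁₁₁₁)/2`. -/
noncomputable def cluster4 : ((Fin 2 × Fin 2) × Fin 2) × Fin 2 → ℂ :=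
  (1 / 2 : ℂ) • (e4 0 0 0 0 + e4 0 0 1 1 + e4 1 1 0 0 - e4 1 1 1 1)

/-- The Bell states `Φ± = (e₀₀ ± e₁₁)/√2`. -/
noncomputable def PhiPlus : Fin 2 × Fin 2 → ℂ := (Real.sqrt 2 : ℂ)⁻¹ • (e2 0 0 + e2 1 1)
noncomputable def PhiMinus : Fin 2 × Fin 2 → ℂ := (Real.sqrt 2 : ℂ)⁻¹ • (e2 0 0 - e2 1 1)

theorem sqrt_two_inv_mul_self : ((Real.sqrt 2 : ℂ))⁻¹ * (Real.sqrt 2 : ℂ)⁻¹ = 1 / 2 := by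
  rw [← mul_inv, ← Complex.ofReal_mul, Real.mul_self_sqrt zero_le_two]
  norm_num

/-- The projector onto a unit vector is a density matrix. -/
theorem isDensityMatrix_vecMulVec {d : Type*} [Fintype d] [DecidableEq d] {v : d → ℂ}
    (hv : v ⬝ᵥ star v = 1) : IsDensityMatrix (vecMulVec v (star v)) :=
  ⟨posSemidef_vecMulVec_self_star v, by rw [trace_vecMulVec, hv]⟩

theorem qubit_dotProduct_star_self (i : Fin 2) : qubit i ⬝ᵥ star (qubit i) = 1 := by
  simp [dotProduct, qubit]

theorem phiPlus_dotProduct_star_self : PhiPlus ⬝ᵥ star PhiPlus = 1 := by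
  simp [dotProduct, PhiPlus, e2, Fintype.sum_prod_type, Fin.sum_univ_two]
  rw [sqrt_two_inv_mul_self]
  norm_num

theorem phiMinus_dotProduct_star_self : PhiMinus ⬝ᵥ star PhiMinus = 1 := by
  simp [dotProduct, PhiMinus, e2, Fintype.sum_prod_type, Fin.sum_univ_two]
  rw [sqrt_two_inv_mul_self]
  norm_num

/-- The Schmidt-type expansion `η₄ = (Φ⁺ ⊗ e₀ ⊗ e₀ + Φ⁻ ⊗ e₁ ⊗ e₁)/√2`. -/
theorem cluster4_apply (s : Fin 2 × Fin 2) (k u : Fin 2) :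
    cluster4 ((s, k), u) = (Real.sqrt 2 : ℂ)⁻¹ *
      (PhiPlus s * qubit 0 k * qubit 0 u + PhiMinus s * qubit 1 k * qubit 1 u) := by
  simp only [PhiPlus, PhiMinus, Pi.smul_apply, smul_eq_mul, mul_assoc, ← mul_add]
  rw [← mul_assoc, sqrt_two_inv_mul_self]
  obtain ⟨a, b⟩ := s
  fin_cases k <;> fin_cases u <;> simp [cluster4, e4, e2, qubit]

theorem ptrace_cluster4 :
    ptrace (vecMulVec cluster4 (star cluster4))
        = (1 / 2 : ℂ) •
            (vecMulVec PhiPlus (star PhiPlus) ⊗ₖ vecMulVec (qubit 0) (star (qubit 0)))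
          + (1 / 2 : ℂ) •
            (vecMulVec PhiMinus (star PhiMinus) ⊗ₖ vecMulVec (qubit 1) (star (qubit 1))) := by
  ext ⟨s, k⟩ ⟨t, l⟩
  have key (x y : ℂ) : (Real.sqrt 2 : ℂ)⁻¹ * x * ((Real.sqrt 2 : ℂ)⁻¹ * y) = 1 / 2 * (x * y) := by
    rw [mul_mul_mul_comm, sqrt_two_inv_mul_self]
  simp only [ptrace, of_apply, vecMulVec_apply, Pi.star_apply, cluster4_apply, map_mul,
    map_inv₀, Complex.star_def, Complex.conj_ofReal, key, Fin.sum_univ_two, Matrix.add_apply,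
    Matrix.smul_apply, kroneckerMap_apply, smul_eq_mul]
  fin_cases k <;> fin_cases l <;> simp [qubit]

/-- the partial trace of the four-qubit cluster state `|η₄⟩⟨η₄|` over the
last qubit equals `(1/2)|Φ⁺⟩⟨Φ⁺|⊗|0⟩⟨0| + (1/2)|Φ⁻⟩⟨Φ⁻|⊗|1⟩⟨1|`; in particular it is
biseparable across the cut separating the third qubit. -/
theorem persistency_stmt12 :
    ptrace (vecMulVec cluster4 (star cluster4))
        = (1 / 2 : ℂ) •
            (vecMulVec PhiPlus (star PhiPlus) ⊗ₖ vecMulVec (qubit 0) (star (qubit 0)))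
          + (1 / 2 : ℂ) •
            (vecMulVec PhiMinus (star PhiMinus) ⊗ₖ vecMulVec (qubit 1) (star (qubit 1))) ∧
    ∃ (n : ℕ) (p : Fin n → ℝ) (ρAB : Fin n → Matrix (Fin 2 × Fin 2) (Fin 2 × Fin 2) ℂ)
      (ρC : Fin n → Matrix (Fin 2) (Fin 2) ℂ),
      (∀ k, 0 ≤ p k) ∧ (∑ k, p k = 1) ∧
      (∀ k, IsDensityMatrix (ρAB k)) ∧ (∀ k, IsDensityMatrix (ρC k)) ∧
      ptrace (vecMulVec cluster4 (star cluster4))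
        = ∑ k, (p k : ℂ) • (ρAB k ⊗ₖ ρC k) := by
  refine ⟨ptrace_cluster4, 2, fun _ => 1 / 2,
    ![vecMulVec PhiPlus (star PhiPlus), vecMulVec PhiMinus (star PhiMinus)],
    fun k => vecMulVec (qubit k) (star (qubit k)), fun _ => by norm_num, by norm_num, ?_,
    fun k => isDensityMatrix_vecMulVec (qubit_dotProduct_star_self k), ?_⟩
  · exact Fin.forall_fin_two.2 ⟨isDensityMatrix_vecMulVec phiPlus_dotProduct_star_self,
      isDensityMatrix_vecMulVec phiMinus_dotProduct_star_self⟩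
  · rw [ptrace_cluster4, Fin.sum_univ_two]
    simp
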